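/- Essential finiteness is stable under orthogonality: a positive behaviour P is essentially finite if and only if P⊥ is essentially finite. -/

import Mathlib

namespace Ludics

abbrev Address := List ℕ

/-- An action of Ludics: the daimon, or a proper action given by a polarity
(`true` = positive), a focus address and a ramification. -/
inductive Action where
  | daimon : Action
  | proper (pos : Bool) (focus : Address) (ram : Finset ℕ) : Action
deriving DecidableEq

namespace Action

def isPositive : Action → Bool
  | daimon => true
  | proper pos _ _ => pos

def focus? : Action → Option Address
  | daimon => none
  | proper _ ξ _ => some ξ

/-- Reverse the polarity of an action. -/
def dual : Action → Action
  | daimon => daimon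
  | proper pos ξ I => proper (!pos) ξ I

/-- `a.justifiesB b` : the focus of `b` is one of the addresses created by `a`. -/
def justifiesB : Action → Action → Bool
  | proper _ ξ I, proper _ ζ _ => decide (∃ i ∈ I, ζ = ξ ++ [i])
  | _, _ => false

def justifies (a b : Action) : Prop := a.justifiesB b = true

end Action

/-- A sequent of a base: an optional left address (at most one) and a finite
set of right addresses. -/
structure Sequent where
  left : Option Address
  right : Finset Address

abbrev Base := List Sequent

def Base.isPositive (β : Base) : Prop := ∃ σ ∈ β, σ.left = none

/-- An action is initial w.r.t. a base if its focus belongs to the base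
(on the side corresponding to its polarity). -/
def Initial (β : Base) (a : Action) : Prop :=
  ∃ pol ξ I, a = .proper pol ξ I ∧
    ∃ σ ∈ β, (pol = true ∧ ξ ∈ σ.right) ∨ (pol = false ∧ σ.left = some ξ)

/-- A sequent "owns" an action when its focus is hereditarily justified by an
address of the sequent (i.e. extends an address of the sequent). -/
def Sequent.owns (σ : Sequent) (a : Action) : Prop :=
  ∃ ξ, a.focus? = some ξ ∧
    ((∃ γ, σ.left = some γ ∧ γ <+: ξ) ∨ (∃ δ ∈ σ.right, δ <+: ξ))

def Sequent.addresses (σ : Sequent) : Set Address :=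
  (match σ.left with | some γ => {γ} | none => ∅) ∪ ↑σ.right

def Base.addresses (β : Base) : Set Address :=
  {a | ∃ σ ∈ β, a ∈ σ.addresses}

/-- The dual base: each sequent `Γ ⊢ Δ` gives sequents `⊢ Γ` and `δ ⊢` for δ ∈ Δ. -/
noncomputable def Sequent.dualSequents (σ : Sequent) : List Sequent :=
  (match σ.left with
    | some γ => [⟨none, ({γ} : Finset Address)⟩]
    | none => []) ++
    σ.right.toList.map fun δ => ⟨some δ, (∅ : Finset Address)⟩

noncomputable def Base.dual (β : Base) : Base := (β.map Sequent.dualSequents).flatten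

/-- View of a sequence, computed on the reversed sequence (most recent action
first), with fuel. -/
def viewRevAux : ℕ → List Action → List Action
  | 0, _ => []
  | _ + 1, [] => []
  | n + 1, a :: w =>
    if a.isPositive then a :: viewRevAux n w
    else a :: viewRevAux n (w.dropWhile fun b => !(b.justifiesB a))

def viewRev (s : List Action) : List Action := viewRevAux s.length s

/-- The view `⌜s⌝` of a sequence of actions. -/
def view (s : List Action) : List Action := (viewRev s.reverse).reverse

/-- `p` is a path based on `β`. -/
structure IsPath (β : Base) (p : List Action) : Prop where
  alternating : p.Chain' fun a b => a.isPositive ≠ b.isPositive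
  justified : ∀ w a, w ++ [a] <+: p → a ≠ Action.daimon →
    Initial β a ∨ ∃ b ∈ w, b.justifies a
  negJump : ∀ w a b, w ++ [a] <+: p → a.isPositive = true → b ∈ w →
    b.justifies a → b ∈ view w
  posJump : ∀ w a, w ++ [a] <+: p → a.isPositive = true → a ≠ Action.daimon →
    ∀ σ ∈ β, (∃ f, a.focus? = some f ∧ f ∈ σ.right) →
      (w = [] ∧ σ.left = none) ∨
      ∃ w' b, w = w' ++ [b] ∧ b.isPositive = false ∧ σ.owns b
  linearity : (p.filterMap Action.focus?).Nodup
  daimonLast : ∀ w, w ++ [Action.daimon] <+: p → w ++ [Action.daimon] = p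
  daimonFirst : p.head? = some Action.daimon → β.isPositive
  totality : β.isPositive → ∃ a t, p = a :: t ∧
    (a = Action.daimon ∨ (a.isPositive = true ∧ Initial β a))

/-- A chronicle: a non-empty path where each non-initial negative action is
justified by the immediately preceding action. -/
def IsChronicle (β : Base) (c : List Action) : Prop :=
  IsPath β c ∧ c ≠ [] ∧
    ∀ w a b, w ++ [a, b] <+: c → b.isPositive = false →
      Initial β b ∨ a.justifies b

/-- The dual of a positive-ended sequence: reverse all polarities, removing a
final daimon if present and appending one otherwise. -/
def dualSeq (p : List Action) : List Action :=
  if p.getLast? = some Action.daimon then p.dropLast.map Action.dual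
  else p.map Action.dual ++ [Action.daimon]

/-- Positive-ended (possibly empty) sequence. -/
def PosEnded (p : List Action) : Prop :=
  p = [] ∨ ∃ a, p.getLast? = some a ∧ a.isPositive = true

/-- A (non-empty) negative-starting, positive-ended block. -/
def NegBlock (b : List Action) : Prop :=
  b ≠ [] ∧ (∀ a, b.head? = some a → a.isPositive = false) ∧
    ∀ a, b.getLast? = some a → a.isPositive = true

def EndsWithDaimon (p : List Action) : Prop := p.getLast? = some Action.daimon

/-- Basic shuffle of two positive-ended negative paths: interleaving by
positive-ended negative blocks; if the last `p`-block ends with the daimon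
then the last `q`-block is empty. -/
def ShuffleNeg (p q r : List Action) : Prop :=
  ∃ ps qs : List (List Action),
    ps.length = qs.length ∧
    (∀ b ∈ ps, b = [] ∨ NegBlock b) ∧
    (∀ b ∈ qs, b = [] ∨ NegBlock b) ∧
    ps.flatten = p ∧ qs.flatten = q ∧
    (List.zipWith (· ++ ·) ps qs).flatten = r ∧
    (EndsWithDaimon (ps.getLast?.getD []) → qs.getLast?.getD [] = [])

/-- The shuffle `r ∈ p ⧢ q`, including the extensions to two daimon-ended
paths and to paths with a common positive-ended prefix. -/
inductive Shuffle : List Action → List Action → List Action → Prop where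
  | base {p q r} : ShuffleNeg p q r → Shuffle p q r
  | daiLeft {p q r} {κ₁ κ₂ : Action} :
      Shuffle (p ++ [κ₁, Action.daimon]) q r →
      Shuffle (p ++ [κ₁, Action.daimon]) (q ++ [κ₂, Action.daimon]) r
  | daiRight {p q r} {κ₁ κ₂ : Action} :
      Shuffle p (q ++ [κ₂, Action.daimon]) r →
      Shuffle (p ++ [κ₁, Action.daimon]) (q ++ [κ₂, Action.daimon]) r
  | pre {s p q r} : s ≠ [] → PosEnded s → Shuffle p q r →
      Shuffle (s ++ p) (s ++ q) (s ++ r)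

/-- Shuffle closure of a set of (positive-ended) paths. -/
inductive ShuffleClosure (P : Set (List Action)) : List Action → Prop where
  | mem {p} : p ∈ P → ShuffleClosure P p
  | shuffle {p q r} : ShuffleClosure P p → ShuffleClosure P q →
      Shuffle p q r → ShuffleClosure P r

/-- Coherence of chronicles: comparability and propagation. -/
def Coherent (c₁ c₂ : List Action) : Prop :=
  (∀ w κ₁ κ₂, w ++ [κ₁] <+: c₁ → w ++ [κ₂] <+: c₂ →
      κ₁ = κ₂ ∨ (κ₁.isPositive = false ∧ κ₂.isPositive = false)) ∧
  (∀ w ξ₁ I₁ w₁ σ₁ ξ₂ I₂ w₂ σ₂,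
      w ++ Action.proper false ξ₁ I₁ :: w₁ ++ [σ₁] <+: c₁ →
      w ++ Action.proper false ξ₂ I₂ :: w₂ ++ [σ₂] <+: c₂ →
      ξ₁ ≠ ξ₂ → ∀ f, σ₁.focus? = some f → σ₂.focus? ≠ some f)

/-- A design, as a prefix-closed clique of chronicles. -/
structure IsDesign (β : Base) (D : Set (List Action)) : Prop where
  chron : ∀ c ∈ D, IsChronicle β c
  prefixClosed : ∀ c ∈ D, ∀ d, d <+: c → d ≠ [] → d ∈ D
  coherent : ∀ c ∈ D, ∀ d ∈ D, Coherent c d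
  maxPos : ∀ c ∈ D, (∀ κ, c ++ [κ] ∉ D) →
    ∃ a, c.getLast? = some a ∧ a.isPositive = true
  posNonempty : β.isPositive → D.Nonempty

/-- A net of designs, abusively seen as its set of chronicles. -/
structure IsNet (β : Base) (R : Set (List Action)) : Prop where
  chron : ∀ c ∈ R, IsChronicle β c
  prefixClosed : ∀ c ∈ R, ∀ d, d <+: c → d ≠ [] → d ∈ R

/-- `p` is a path of the design/net `D`: each view of each non-empty prefix of
`p` is a chronicle of `D`. -/
def PathOf (β : Base) (D : Set (List Action)) (p : List Action) : Prop :=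
  IsPath β p ∧ ∀ q, q <+: p → q ≠ [] → view q ∈ D

/-- Whose turn it is in normalization: `dpos` says whether the design `D` owns
the first (positive) move; afterwards `D` moves exactly after negative actions. -/
def TurnD (dpos : Prop) (s : List Action) : Prop :=
  match s.getLast? with
  | none => dpos
  | some a => a.isPositive = false

/-- Interaction (normalization) between a design `D` and a counter-net `R`,
described by its visited sequence `s` (seen from `D`): it converges from
state `s` if the design to move plays the daimon, or it plays a proper
positive action accepted (in dual form) by the other one, and the interaction
converges from the extended state. -/
inductive Conv (D R : Set (List Action)) (dpos : Prop) : List Action → Prop where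
  | daiD {s} : TurnD dpos s → view (s ++ [Action.daimon]) ∈ D → Conv D R dpos s
  | daiR {s} : ¬ TurnD dpos s →
      view (s.map Action.dual ++ [Action.daimon]) ∈ R → Conv D R dpos s
  | stepD {s κ} : TurnD dpos s → κ.isPositive = true → κ ≠ Action.daimon →
      view (s ++ [κ]) ∈ D → view ((s ++ [κ]).map Action.dual) ∈ R →
      Conv D R dpos (s ++ [κ]) → Conv D R dpos s
  | stepR {s κ} : ¬ TurnD dpos s → κ.isPositive = false →
      view ((s ++ [κ]).map Action.dual) ∈ R → view (s ++ [κ]) ∈ D →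
      Conv D R dpos (s ++ [κ]) → Conv D R dpos s

/-- The simple base `⊢ ξ` (positive) or `ξ ⊢` (negative). -/
def simpleBase (ξ : Address) (pos : Bool) : Base :=
  if pos then [⟨none, {ξ}⟩] else [⟨some ξ, ∅⟩]

/-- The orthogonal of a set of designs on a simple base. -/
def orthSet (ξ : Address) (pos : Bool) (A : Set (Set (List Action))) :
    Set (Set (List Action)) :=
  {E | IsDesign (simpleBase ξ !pos) E ∧
    ∀ D ∈ A, if pos then Conv D E True [] else Conv E D True []}

def biorth (ξ : Address) (pos : Bool) (A : Set (Set (List Action))) :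
    Set (Set (List Action)) :=
  orthSet ξ (!pos) (orthSet ξ pos A)

/-- A behaviour: a bi-orthogonally closed set of designs on a simple base. -/
structure Behaviour (ξ : Address) (pos : Bool) where
  designs : Set (Set (List Action))
  isDesign : ∀ D ∈ designs, IsDesign (simpleBase ξ pos) D
  closed : designs = biorth ξ pos designs

/-- Visitable paths of a set of designs: traces of convergent normalizations
with the orthogonal, characterized as the dual pairs of paths. -/
def VisitableSet (ξ : Address) (pos : Bool) (S : Set (Set (List Action)))
    (p : List Action) : Prop :=
  ∃ D ∈ S, ∃ E ∈ orthSet ξ pos S,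
    PathOf (simpleBase ξ pos) D p ∧ PathOf (simpleBase ξ !pos) E (dualSeq p)

def Visitable {ξ : Address} {pos : Bool} (A : Behaviour ξ pos)
    (p : List Action) : Prop :=
  VisitableSet ξ pos A.designs p

/-- Material (incarnated) design of a behaviour: inclusion-minimal. -/
def Material {ξ : Address} {pos : Bool} (A : Behaviour ξ pos)
    (D : Set (List Action)) : Prop :=
  D ∈ A.designs ∧ ∀ E ∈ A.designs, E ⊆ D → E = D

/-- Completion of a design: add daimon-ended chronicles after every missing
negative action. -/
def completion (β : Base) (D : Set (List Action)) : Set (List Action) :=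
  D ∪ {c' | ∃ c ∈ D, ∃ ξ I,
    (c' = c ++ [Action.proper false ξ I] ∨
      c' = c ++ [Action.proper false ξ I, Action.daimon]) ∧
    IsChronicle β (c ++ [Action.proper false ξ I, Action.daimon]) ∧
    c ++ [Action.proper false ξ I] ∉ D}

def DaiDesign : Set (List Action) := {[Action.daimon]}

def firstAction (D : Set (List Action)) (κ : Action) : Prop :=
  ∃ c ∈ D, c.head? = some κ

/-- Directory of a set of positive designs on `⊢ ξ`. -/
def directory (ξ : Address) (A : Set (Set (List Action))) : Set (Finset ℕ) :=
  {I | ∃ D ∈ A, firstAction D (Action.proper true ξ I)}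

/-- Alien positive behaviours: ramifications of first actions pairwise disjoint. -/
def Alien (ξ : Address) (A B : Behaviour ξ true) : Prop :=
  ∀ I ∈ directory ξ A.designs, ∀ J ∈ directory ξ B.designs, Disjoint I J

/-- Extension of the first action of a design by a set `J`. -/
def extDesign (ξ : Address) (J : Finset ℕ) (D : Set (List Action)) :
    Set (List Action) :=
  {c | ∃ I t, (Action.proper true ξ I :: t) ∈ D ∧
      c = Action.proper true ξ (I ∪ J) :: t}

/-- The extension `A_[B]` of a set of designs along another. -/
def extended (ξ : Address) (A B : Set (Set (List Action))) :
    Set (Set (List Action)) :=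
  insert DaiDesign
    {D' | ∃ D ∈ A, (∃ I, firstAction D (Action.proper true ξ I)) ∧
      ∃ E ∈ B, ∃ J, firstAction E (Action.proper true ξ J) ∧
        D' = extDesign ξ J D}

/-- The extension `P_[Q]` of a set of paths along another. -/
def extPaths (ξ : Address) (P Q : Set (List Action)) : Set (List Action) :=
  insert [Action.daimon]
    {p | ∃ I t, (Action.proper true ξ I :: t) ∈ P ∧
      ∃ q ∈ Q, ∃ J, q.head? = some (Action.proper true ξ J) ∧
        p = Action.proper true ξ (I ∪ J) :: t}

/-- Prefixing a (negative) design by the positive action `(+, ξ, {i})`. -/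
def shiftD (ξ : Address) (i : ℕ) (D : Set (List Action)) : Set (List Action) :=
  insert [Action.proper true ξ {i}]
    {c | ∃ d ∈ D, c = Action.proper true ξ {i} :: d}

/-- `C = ↑N` : the positive shift of the negative behaviour `N`. -/
def IsShiftOf (ξ : Address) (i : ℕ) (C : Behaviour ξ true)
    (N : Behaviour (ξ ++ [i]) false) : Prop :=
  C.designs = biorth ξ true (shiftD ξ i '' N.designs)

/-- `C = ⊕ₖ F k`. -/
def IsSumOf {ξ : Address} {ι : Type} (C : Behaviour ξ true)
    (F : ι → Behaviour ξ true) : Prop :=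
  C.designs = biorth ξ true (⋃ k, (F k).designs)

/-- Pairwise disjoint family of positive behaviours (disjoint directories). -/
def PairwiseDisjointFam {ξ : Address} {ι : Type}
    (F : ι → Behaviour ξ true) : Prop :=
  ∀ k l, k ≠ l → ∀ I ∈ directory ξ (F k).designs,
    I ∉ directory ξ (F l).designs

open Classical in
/-- Tensor of two positive designs on `⊢ ξ`. -/
noncomputable def tensorD (ξ : Address) (D E : Set (List Action)) :
    Set (List Action) :=
  if D = DaiDesign ∨ E = DaiDesign then DaiDesign
  else {c | ∃ I J, firstAction D (Action.proper true ξ I) ∧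
      firstAction E (Action.proper true ξ J) ∧
      ∃ t, ((Action.proper true ξ I :: t) ∈ D ∨
            (Action.proper true ξ J :: t) ∈ E) ∧
        c = Action.proper true ξ (I ∪ J) :: t}

/-- `C = A ⊗ B`. -/
def IsTensorOf {ξ : Address} (C A B : Behaviour ξ true) : Prop :=
  C.designs = biorth ξ true
    {G | ∃ D ∈ A.designs, ∃ E ∈ B.designs, G = tensorD ξ D E}

/-- Hereditary chains of justifiers inside a sequence `p`. -/
inductive JustChain (β : Base) (p : List Action) : List Action → Prop where
  | init {κ} : κ ∈ p → Initial β κ → JustChain β p [κ]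
  | cons {s κ κ'} : JustChain β p (s ++ [κ]) → κ' ∈ p → κ.justifies κ' →
      JustChain β p (s ++ [κ, κ'])

/-- Trivial chronicle for a behaviour: hereditary-justifier sequence of an
action of a chronicle of a material design. -/
def TrivialChronicle {ξ : Address} {pos : Bool} (A : Behaviour ξ pos)
    (s : List Action) : Prop :=
  ∃ D, Material A D ∧ ∃ c ∈ D, JustChain (simpleBase ξ pos) c s

/-- Regular path for a behaviour: reversible path whose justifier chains are
trivial chronicles for the behaviour. -/
def RegularPath {ξ : Address} {pos : Bool} (A : Behaviour ξ pos)
    (p : List Action) : Prop :=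
  IsPath (simpleBase ξ pos) p ∧ IsPath (simpleBase ξ !pos) (dualSeq p) ∧
  ∀ κ ∈ p, κ ≠ Action.daimon →
    ∃ s, JustChain (simpleBase ξ pos) p s ∧ s.getLast? = some κ ∧
      TrivialChronicle A s

/-- Regular behaviour: every regular path is visitable. -/
def Regular {ξ : Address} {pos : Bool} (A : Behaviour ξ pos) : Prop :=
  ∀ p, RegularPath A p → Visitable A p

/-- Proper actions occurring in a design. -/
def properActs (D : Set (List Action)) : Set Action :=
  {a | a ≠ Action.daimon ∧ ∃ c ∈ D, a ∈ c}

/-- Essentially finite behaviour: finitely many material designs, all finite. -/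
def EssFinite {ξ : Address} {pos : Bool} (A : Behaviour ξ pos) : Prop :=
  {D | Material A D}.Finite ∧ ∀ D, Material A D → (properActs D).Finite

/-- A slice of a design. -/
def IsSlice (D S : Set (List Action)) : Prop :=
  S ⊆ D ∧ (∀ c ∈ S, ∀ d, d <+: c → d ≠ [] → d ∈ S) ∧
  ∀ w ξ I₁ I₂, w ++ [Action.proper false ξ I₁] ∈ S →
    w ++ [Action.proper false ξ I₂] ∈ S → I₁ = I₂

/-- Uniformly bounded behaviour: slice sizes of material designs uniformly
bounded. -/
def UnifBounded {ξ : Address} {pos : Bool} (A : Behaviour ξ pos) : Prop :=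
  ∃ N : ℕ, ∀ D, Material A D → ∀ S, IsSlice D S →
    (properActs S).Finite ∧ (properActs S).ncard < N

def oneDesign (ξ : Address) : Set (List Action) :=
  {[Action.proper true ξ ∅]}

mutual
  /-- The class `C∞⁺` of positive behaviours: `0`, `1`, or a (possibly
  infinite) nonempty sum of finite tensors of shifts of `C∞⁻` elements. -/
  inductive CInf : (ξ : Address) → Behaviour ξ true → Prop where
    | zero {ξ} (A : Behaviour ξ true) :
        A.designs = {DaiDesign} → CInf ξ A
    | one {ξ} (A : Behaviour ξ true) :
        A.designs = biorth ξ true {oneDesign ξ} → CInf ξ A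
    | sum {ξ} {ι : Type} (F : ι → Behaviour ξ true) (C : Behaviour ξ true) :
        Nonempty ι → (∀ k, CInfTS ξ (F k)) → PairwiseDisjointFam F →
        IsSumOf C F → CInf ξ C
  /-- Finite tensors of positive shifts of duals of `C∞⁺` elements. -/
  inductive CInfTS : (ξ : Address) → Behaviour ξ true → Prop where
    | shift {ξ} {i : ℕ} (C : Behaviour ξ true) (N : Behaviour (ξ ++ [i]) false)
        (P : Behaviour (ξ ++ [i]) true) :
        CInf (ξ ++ [i]) P → N.designs = orthSet (ξ ++ [i]) true P.designs →
        IsShiftOf ξ i C N → CInfTS ξ C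
    | tensor {ξ} (A B C : Behaviour ξ true) :
        CInfTS ξ A → CInfTS ξ B → Alien ξ A B → IsTensorOf C A B →
        CInfTS ξ C
end

mutual
  /-- The class `C_f⁺`: as `C∞⁺` but with finite sums only. -/
  inductive CFin : (ξ : Address) → Behaviour ξ true → Prop where
    | zero {ξ} (A : Behaviour ξ true) :
        A.designs = {DaiDesign} → CFin ξ A
    | one {ξ} (A : Behaviour ξ true) :
        A.designs = biorth ξ true {oneDesign ξ} → CFin ξ A
    | sum {ξ} {ι : Type} (F : ι → Behaviour ξ true) (C : Behaviour ξ true) :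
        Nonempty ι → Finite ι → (∀ k, CFinTS ξ (F k)) → PairwiseDisjointFam F →
        IsSumOf C F → CFin ξ C
  inductive CFinTS : (ξ : Address) → Behaviour ξ true → Prop where
    | shift {ξ} {i : ℕ} (C : Behaviour ξ true) (N : Behaviour (ξ ++ [i]) false)
        (P : Behaviour (ξ ++ [i]) true) :
        CFin (ξ ++ [i]) P → N.designs = orthSet (ξ ++ [i]) true P.designs →
        IsShiftOf ξ i C N → CFinTS ξ C
    | tensor {ξ} (A B C : Behaviour ξ true) :
        CFinTS ξ A → CFinTS ξ B → Alien ξ A B → IsTensorOf C A B →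
        CFinTS ξ C
end

/-- The class `C∞⁻` : duals of `C∞⁺` elements. -/
def CInfN (ξ : Address) (B : Behaviour ξ false) : Prop :=
  ∃ A : Behaviour ξ true, CInf ξ A ∧ B.designs = orthSet ξ true A.designs

def CFinN (ξ : Address) (B : Behaviour ξ false) : Prop :=
  ∃ A : Behaviour ξ true, CFin ξ A ∧ B.designs = orthSet ξ true A.designs

theorem dual_dual' (a : Action) : a.dual.dual = a := by
  cases a <;> simp [Action.dual]

theorem dual_pos {a : Action} (h : a ≠ Action.daimon) :
    a.dual.isPositive = !a.isPositive := by
  cases a <;> simp_all [Action.dual, Action.isPositive]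

theorem dual_ne {a : Action} (h : a ≠ Action.daimon) : a.dual ≠ Action.daimon := by
  cases a <;> simp_all [Action.dual]

theorem neg_ne {a : Action} (h : a.isPositive = false) : a ≠ Action.daimon := by
  rintro rfl; simp [Action.isPositive] at h

theorem map_dual_dual (s : List Action) : (s.map Action.dual).map Action.dual = s := by
  simp [List.map_map, Function.comp_def, dual_dual']

theorem view_pos (s : List Action) {a : Action} (h : a.isPositive = true) :
    view (s ++ [a]) = view s ++ [a] := by
  simp [view, viewRev, viewRevAux, h]

theorem view_last (s : List Action) (a : Action) : ∃ v, view (s ++ [a]) = v ++ [a] := by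
  by_cases h : a.isPositive = true
  · exact ⟨_, view_pos s h⟩
  · simp [view, viewRev, viewRevAux, h]

theorem viewRevAux_sub (n : ℕ) (s : List Action) : ∀ a ∈ viewRevAux n s, a ∈ s := by
  induction n generalizing s with
  | zero => simp [viewRevAux]
  | succ n ih =>
    cases s with
    | nil => simp [viewRevAux]
    | cons b w =>
      intro a ha
      simp only [viewRevAux] at ha
      split at ha
      · rcases List.mem_cons.1 ha with h | h
        · simp [h]
        · exact List.mem_cons_of_mem _ (ih _ a h)
      · rcases List.mem_cons.1 ha with h | h
        · simp [h]
        · exact List.mem_cons_of_mem _ ((List.dropWhile_sublist _).subset (ih _ a h))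

theorem view_sub (s : List Action) : ∀ a ∈ view s, a ∈ s := by
  intro a ha
  have ha' : a ∈ viewRevAux s.reverse.length s.reverse := by
    simpa [view, viewRev] using ha
  simpa using viewRevAux_sub _ _ a ha'

inductive Reach (D R : Set (List Action)) (p : Prop) : List Action → Prop where
  | nil : Reach D R p []
  | stepD {s κ} : Reach D R p s → TurnD p s → κ.isPositive = true → κ ≠ Action.daimon →
      view (s ++ [κ]) ∈ D → view ((s ++ [κ]).map Action.dual) ∈ R → Reach D R p (s ++ [κ])
  | stepR {s κ} : Reach D R p s → ¬ TurnD p s → κ.isPositive = false →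
      view ((s ++ [κ]).map Action.dual) ∈ R → view (s ++ [κ]) ∈ D → Reach D R p (s ++ [κ])

def inc (Rs : Set (Set (List Action))) (p : Prop) (D : Set (List Action)) :
    Set (List Action) :=
  {c | c ∈ D ∧ ∃ R ∈ Rs, ∃ s, Reach D R p s ∧
    (c <+: view s ∨ (TurnD p s ∧ c = view s ++ [Action.daimon]))}

theorem Reach.proper {D R p s} (h : Reach D R p s) : ∀ a ∈ s, a ≠ Action.daimon := by
  induction h with
  | nil => simp
  | stepD _ _ _ h _ _ ih =>
    intro a ha
    rcases List.mem_append.1 ha with h' | h'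
    · exact ih a h'
    · simp at h'; rwa [h']
  | stepR _ _ h _ _ ih =>
    intro a ha
    rcases List.mem_append.1 ha with h' | h'
    · exact ih a h'
    · simp at h'; rw [h']; exact neg_ne h

theorem turn_dual {p : Prop} {s : List Action} (h : ∀ a ∈ s, a ≠ Action.daimon) :
    TurnD (¬ p) (s.map Action.dual) ↔ ¬ TurnD p s := by
  rcases List.eq_nil_or_concat' s with rfl | ⟨w, a, rfl⟩
  · simp [TurnD]
  · simp [TurnD, dual_pos (h a (by simp))]

theorem Reach.swap {D R p s} (h : Reach D R p s) :
    Reach R D (¬ p) (s.map Action.dual) := by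
  induction h with
  | nil => exact .nil
  | @stepD s κ h ht hp hn hD hR ih =>
    rw [List.map_append] at hR ⊢
    refine .stepR ih ?_ ?_ ?_ hR
    · rw [turn_dual h.proper]; simpa using ht
    · simp [dual_pos hn, hp]
    · simpa [Function.comp_def, dual_dual'] using hD
  | @stepR s κ h ht hp hR hD ih =>
    rw [List.map_append] at hR ⊢
    refine .stepD ih ?_ ?_ ?_ hR ?_
    · rw [turn_dual h.proper]; simpa using ht
    · simp [dual_pos (neg_ne hp), hp]
    · exact dual_ne (neg_ne hp)
    · simpa [Function.comp_def, dual_dual'] using hD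

theorem Conv.swap {D R p s} (h : Conv D R p s) (hs : ∀ a ∈ s, a ≠ Action.daimon) :
    Conv R D (¬ p) (s.map Action.dual) := by
  induction h with
  | daiD ht hD =>
    refine .daiR ?_ ?_
    · rw [turn_dual hs]; simpa using ht
    · rwa [map_dual_dual]
  | daiR ht hR =>
    refine .daiD ?_ hR
    rw [turn_dual hs]; simpa using ht
  | @stepD s κ ht hp hn hD hR hc ih =>
    have hs' : ∀ a ∈ s ++ [κ], a ≠ Action.daimon := by
      intro a ha
      rcases List.mem_append.1 ha with h' | h'
      · exact hs a h'
      · simp at h'; rwa [h']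
    have ih := ih hs'
    have e : (s ++ [κ]).map Action.dual = s.map Action.dual ++ [κ.dual] := by simp
    rw [e] at ih hR
    refine .stepR (κ := κ.dual) ?_ ?_ ?_ hR ih
    · rw [turn_dual hs]; simpa using ht
    · simp [dual_pos hn, hp]
    · rwa [← e, map_dual_dual]
  | @stepR s κ ht hp hR hD hc ih =>
    have hs' : ∀ a ∈ s ++ [κ], a ≠ Action.daimon := by
      intro a ha
      rcases List.mem_append.1 ha with h' | h'
      · exact hs a h'
      · simp at h'; rw [h']; exact neg_ne hp
    have ih := ih hs'
    have e : (s ++ [κ]).map Action.dual = s.map Action.dual ++ [κ.dual] := by simp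
    rw [e] at ih hR
    refine .stepD (κ := κ.dual) ?_ ?_ ?_ hR ?_ ih
    · rw [turn_dual hs]; simpa using ht
    · simp [dual_pos (neg_ne hp), hp]
    · exact dual_ne (neg_ne hp)
    · rwa [← e, map_dual_dual]

theorem coh_eq {β D} (hD : IsDesign β D) {w a b} (ha : w ++ [a] ∈ D) (hb : w ++ [b] ∈ D)
    (h : a.isPositive = true) : a = b := by
  rcases (hD.coherent _ ha _ hb).1 w a b (List.prefix_refl _) (List.prefix_refl _) with h' | h'
  · exact h'
  · simp [h] at h'

/-- Determinism on the side of the mover `D`. -/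
theorem conv_det {β β' D R p} (hD : IsDesign β D) (hR : IsDesign β' R) {s}
    (h : Reach D R p s) (h0 : Conv D R p []) : Conv D R p s := by
  induction h with
  | nil => exact h0
  | @stepD s κ h ht hp hn hvD hvR ih =>
    cases ih with
    | daiD _ h1 =>
      rw [view_pos _ hp] at hvD
      rw [view_pos _ rfl] at h1
      exact absurd (coh_eq hD hvD h1 hp) hn
    | daiR h1 => exact absurd ht h1
    | stepD _ hp' hn' h1 h2 h3 =>
      rw [view_pos _ hp] at hvD
      rw [view_pos _ hp'] at h1
      rw [coh_eq hD hvD h1 hp]; exact h3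
    | stepR h1 => exact absurd ht h1
  | @stepR s κ h ht hp hvR hvD ih =>
    have e : ∀ κ : Action, (s ++ [κ]).map Action.dual = s.map Action.dual ++ [κ.dual] := by simp
    have hp1 : κ.dual.isPositive = true := by simp [dual_pos (neg_ne hp), hp]
    rw [e, view_pos _ hp1] at hvR
    cases ih with
    | daiR _ h1 =>
      rw [view_pos _ rfl] at h1
      exact absurd (coh_eq hR hvR h1 hp1) (dual_ne (neg_ne hp))
    | daiD h1 => exact absurd h1 ht
    | stepR _ hp' h1 h2 h3 =>
      rw [e, view_pos _ (by simp [dual_pos (neg_ne hp'), hp'])] at h1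
      have := congrArg Action.dual (coh_eq hR hvR h1 hp1)
      rw [dual_dual', dual_dual'] at this
      rw [this]; exact h3
    | stepD h1 => exact absurd h1 ht

/-- A sub-design reaches the same positions. -/
theorem reach_sub {β β' D E R p} (hD : IsDesign β D) (hR : IsDesign β' R)
    (hE : IsDesign β E) (hsub : E ⊆ D) (h0 : Conv E R p []) {s}
    (h : Reach D R p s) : Reach E R p s := by
  induction h with
  | nil => exact .nil
  | @stepD s κ h ht hp hn hvD hvR ih =>
    refine .stepD ih ht hp hn ?_ hvR
    cases conv_det hE hR ih h0 with
    | daiD _ h1 =>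
      have h1 := hsub h1
      rw [view_pos _ hp] at hvD
      rw [view_pos _ rfl] at h1
      exact absurd (coh_eq hD hvD h1 hp) hn
    | daiR h1 => exact absurd ht h1
    | stepD _ hp' hn' h1 h2 h3 =>
      have h1' := hsub h1
      rw [view_pos _ hp] at hvD
      rw [view_pos _ hp'] at h1'
      rw [coh_eq hD hvD h1' hp]; exact h1
    | stepR h1 => exact absurd ht h1
  | @stepR s κ h ht hp hvR hvD ih =>
    refine .stepR ih ht hp hvR ?_
    have e : ∀ κ : Action, (s ++ [κ]).map Action.dual = s.map Action.dual ++ [κ.dual] := by simp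
    have hp1 : κ.dual.isPositive = true := by simp [dual_pos (neg_ne hp), hp]
    rw [e, view_pos _ hp1] at hvR
    cases conv_det hE hR ih h0 with
    | daiR _ h1 =>
      rw [view_pos _ rfl] at h1
      exact absurd (coh_eq hR hvR h1 hp1) (dual_ne (neg_ne hp))
    | daiD h1 => exact absurd h1 ht
    | stepR _ hp' h1 h2 h3 =>
      rw [e, view_pos _ (by simp [dual_pos (neg_ne hp'), hp'])] at h1
      have := congrArg Action.dual (coh_eq hR hvR h1 hp1)
      rw [dual_dual', dual_dual'] at this
      rw [this]; exact h2
    | stepD h1 => exact absurd h1 ht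

structure Half (β β' : Base) (Ds Rs : Set (Set (List Action))) (p : Prop) : Prop where
  hD : ∀ D ∈ Ds, IsDesign β D
  hR : ∀ R ∈ Rs, IsDesign β' R
  conv : ∀ D ∈ Ds, ∀ R ∈ Rs, Conv D R p []
  closed : ∀ D, IsDesign β D → (∀ R ∈ Rs, Conv D R p []) → D ∈ Ds
  pos : β.isPositive → p ∧ Rs.Nonempty

theorem conv_inc {D R p Rs} (hR : R ∈ Rs) {s} (h : Conv D R p s) (hr : Reach D R p s) :
    Conv D R p s → Conv (inc Rs p D) R p s := by
  intro _
  induction h with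
  | daiD ht h1 =>
    refine .daiD ht ⟨h1, R, hR, _, hr, .inr ⟨ht, view_pos _ rfl⟩⟩
  | daiR ht h1 => exact .daiR ht h1
  | stepD ht hp hn h1 h2 h3 ih =>
    have hr' := Reach.stepD hr ht hp hn h1 h2
    exact .stepD ht hp hn ⟨h1, R, hR, _, hr', .inl (List.prefix_refl _)⟩ h2 (ih hr' h3)
  | stepR ht hp h1 h2 h3 ih =>
    have hr' := Reach.stepR hr ht hp h1 h2
    exact .stepR ht hp h1 ⟨h2, R, hR, _, hr', .inl (List.prefix_refl _)⟩ (ih hr' h3)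

theorem Half.inc_design {β β' Ds Rs p} (H : Half β β' Ds Rs p) {D} (hD : D ∈ Ds) :
    IsDesign β (inc Rs p D) := by
  have hd := H.hD D hD
  refine ⟨fun c hc => hd.chron c hc.1, ?_, fun c hc d h => hd.coherent c hc.1 d h.1, ?_, ?_⟩
  · rintro c ⟨hc, R, hR, s, hr, h⟩ d hdc hne
    refine ⟨hd.prefixClosed c hc d hdc hne, R, hR, s, hr, ?_⟩
    rcases h with h | ⟨ht, rfl⟩
    · exact .inl (hdc.trans h)
    · rcases List.prefix_concat_iff.1 hdc with h | h
      · exact .inr ⟨ht, h⟩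
      · exact .inl h
  · rintro c ⟨hc, R, hR, s, hr, h⟩ hmax
    rcases h with h | ⟨ht, rfl⟩
    · have hne := (hd.chron c hc).2.1
      have hs : s ≠ [] := by
        rintro rfl
        exact hne (by simpa [view, viewRev, viewRevAux] using h)
      have hvs : view s ∈ D := by
        cases hr with
        | nil => exact absurd rfl hs
        | stepD _ _ _ _ hx => exact hx
        | stepR _ _ _ _ hx => exact hx
      obtain ⟨t, ht⟩ := h
      cases t with
      | cons a t =>
        exfalso
        have hpre : c ++ [a] <+: view s := ⟨t, by rw [← ht]; simp⟩
        exact hmax a ⟨hd.prefixClosed _ hvs _ hpre (by simp), R, hR, s, hr, .inl hpre⟩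
      | nil =>
        simp at ht
        subst ht
        obtain ⟨w, a, rfl⟩ := (List.eq_nil_or_concat' s).resolve_left hs
        obtain ⟨v, hv⟩ := view_last w a
        refine ⟨a, by simp [hv], ?_⟩
        by_contra hp
        have hturn : TurnD p (w ++ [a]) := by simpa [TurnD] using hp
        cases conv_det hd (H.hR R hR) hr (H.conv D hD R hR) with
        | daiD _ h1 =>
          have e := view_pos (w ++ [a]) (a := Action.daimon) rfl
          exact hmax Action.daimon (e ▸ ⟨h1, R, hR, _, hr, .inr ⟨hturn, e⟩⟩)
        | daiR h1 => exact h1 hturn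
        | stepD _ hp' hn' h1 h2 h3 =>
          have e := view_pos (w ++ [a]) hp'
          apply hmax
          rw [← e]
          exact ⟨h1, R, hR, _, Reach.stepD hr hturn hp' hn' h1 h2, .inl (List.prefix_refl _)⟩
        | stepR h1 => exact h1 hturn
    · exact ⟨Action.daimon, by simp, rfl⟩
  · intro hb
    obtain ⟨hp, R, hR⟩ := H.pos hb
    have hturn : TurnD p [] := hp
    cases H.conv D hD R hR with
    | daiD _ h1 => exact ⟨_, h1, R, hR, [], .nil, .inr ⟨hturn, view_pos [] rfl⟩⟩
    | daiR h1 => exact absurd hturn h1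
    | stepD _ hp' hn' h1 h2 h3 =>
      exact ⟨_, h1, R, hR, _, Reach.stepD .nil hturn hp' hn' h1 h2, .inl (List.prefix_refl _)⟩
    | stepR h1 => exact absurd hturn h1

theorem Half.inc_mem {β β' Ds Rs p} (H : Half β β' Ds Rs p) {D} (hD : D ∈ Ds) :
    inc Rs p D ∈ Ds :=
  H.closed _ (H.inc_design hD) fun R hR =>
    conv_inc hR (H.conv D hD R hR) .nil (H.conv D hD R hR)

def Minimal' (Ds : Set (Set (List Action))) (D : Set (List Action)) : Prop :=
  D ∈ Ds ∧ ∀ E ∈ Ds, E ⊆ D → E = D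

theorem Half.inc_min {β β' Ds Rs p} (H : Half β β' Ds Rs p) {D} (hD : D ∈ Ds) :
    Minimal' Ds (inc Rs p D) := by
  refine ⟨H.inc_mem hD, fun E hE hsub => hsub.antisymm ?_⟩
  rintro c ⟨hc, R, hR, s, hr, h⟩
  have hED : E ⊆ D := fun x hx => (hsub hx).1
  have hd := H.hD D hD
  have he := H.hD E hE
  have hr' := reach_sub hd (H.hR R hR) he hED (H.conv E hE R hR) hr
  have hne := (hd.chron c hc).2.1
  rcases h with h | ⟨ht, rfl⟩
  · have hvs : view s ∈ E := by
      cases hr' with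
      | nil => exact absurd (by simpa [view, viewRev, viewRevAux] using h) hne
      | stepD _ _ _ _ hx => exact hx
      | stepR _ _ _ _ hx => exact hx
    exact he.prefixClosed _ hvs c h hne
  · cases conv_det he (H.hR R hR) hr' (H.conv E hE R hR) with
    | daiD _ h1 => rwa [view_pos _ rfl] at h1
    | daiR h1 => exact absurd ht h1
    | stepD _ hp' hn' h1 h2 h3 =>
      have h1 := hED h1
      rw [view_pos _ hp'] at h1
      exact absurd (coh_eq hd h1 hc hp') hn'
    | stepR h1 => exact absurd ht h1

theorem reach_acts {D R p Rs s} (hR : R ∈ Rs) (h : Reach D R p s) :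
    ∀ a ∈ s, ∃ c ∈ inc Rs p D, a ∈ c := by
  have key : ∀ s κ, Reach D R p (s ++ [κ]) → view (s ++ [κ]) ∈ D →
      ∃ c ∈ inc Rs p D, κ ∈ c := by
    intro s κ h hv
    obtain ⟨v, e⟩ := view_last s κ
    exact ⟨_, ⟨hv, R, hR, _, h, .inl (List.prefix_refl _)⟩, by simp [e]⟩
  induction h with
  | nil => simp
  | stepD h ht hp hn h1 h2 ih =>
    intro a ha
    rcases List.mem_append.1 ha with h' | h'
    · exact ih a h'
    · simp at h'; rw [h']; exact key _ _ (.stepD h ht hp hn h1 h2) h1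
  | stepR h ht hp h1 h2 ih =>
    intro a ha
    rcases List.mem_append.1 ha with h' | h'
    · exact ih a h'
    · simp at h'; rw [h']; exact key _ _ (.stepR h ht hp h1 h2) h2

theorem path_length {β c} (hc : IsPath β c) {F : Set Action} (hF : F.Finite)
    (h : ∀ a ∈ c, a ≠ Action.daimon → a ∈ F) : c.length ≤ hF.toFinset.card + 1 := by
  have main : ∀ w : List Action, (w.filterMap Action.focus?).Nodup →
      (∀ a ∈ w, a ≠ Action.daimon ∧ a ∈ F) → w.length ≤ hF.toFinset.card := by
    intro w hw hwF
    have hn : w.Nodup := by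
      have e : (w.filterMap Action.focus?) = w.map (fun a => (a.focus?).getD []) := by
        clear hw
        induction w with
        | nil => rfl
        | cons a w ih =>
          have := ih fun b hb => hwF b (List.mem_cons_of_mem _ hb)
          have h1 := (hwF a (by simp)).1
          cases a with
          | daimon => exact absurd rfl h1
          | proper _ _ _ => simp [Action.focus?, this]
      rw [e] at hw
      exact hw.of_map
    rw [← List.toFinset_card_of_nodup hn]
    exact Finset.card_le_card fun a ha => by simpa using (hwF a (by simpa using ha)).2
  rcases List.eq_nil_or_concat' c with rfl | ⟨w, a, rfl⟩
  · simp
  · have hw : ∀ b ∈ w, b ≠ Action.daimon := by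
      rintro b hb rfl
      obtain ⟨u, v, rfl⟩ := List.append_of_mem hb
      have := hc.daimonLast u ⟨v ++ [a], by simp⟩
      have := congrArg List.length this
      simp at this
    have hl := hc.linearity
    rw [List.filterMap_append] at hl
    have := main w (List.Nodup.of_append_left hl)
      fun b hb => ⟨hw b hb, h b (by simp [hb]) (hw b hb)⟩
    simp; omega

theorem fin_dir {β β' Ds Rs p} (H : Half β β' Ds Rs p) (H' : Half β' β Rs Ds (¬ p))
    (h1 : {D | Minimal' Ds D}.Finite) (h2 : ∀ D, Minimal' Ds D → (properActs D).Finite) :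
    {D | Minimal' Rs D}.Finite ∧ ∀ D, Minimal' Rs D → (properActs D).Finite := by
  have hF0 : (⋃ D ∈ {D | Minimal' Ds D}, properActs D).Finite := h1.biUnion h2
  have hF := hF0.image Action.dual
  set F := Action.dual '' (⋃ D ∈ {D | Minimal' Ds D}, properActs D) with hFdef
  have hacts : ∀ R, Minimal' Rs R → ∀ c ∈ R, ∀ a ∈ c, a ≠ Action.daimon → a ∈ F := by
    intro R hR c hc a ha hn
    have e : inc Ds (¬ p) R = R := hR.2 _ (H'.inc_mem hR.1) fun x hx => hx.1
    rw [← e] at hc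
    obtain ⟨_, D, hD, s, hr, h⟩ := hc
    have has : a ∈ s := by
      rcases h with h | ⟨_, rfl⟩
      · exact view_sub s a (h.subset ha)
      · rcases List.mem_append.1 ha with h | h
        · exact view_sub s a h
        · simp at h; exact absurd h hn
    have hr' := hr.swap
    rw [not_not] at hr'
    obtain ⟨c', hc', hac⟩ := reach_acts hR.1 hr' a.dual (List.mem_map_of_mem has)
    refine ⟨a.dual, ?_, dual_dual' a⟩
    exact Set.mem_biUnion (show inc Rs p D ∈ {D | Minimal' Ds D} from H.inc_min hD)
      ⟨dual_ne hn, c', hc', hac⟩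
  have hG : (insert Action.daimon F).Finite := hF.insert _
  have hC : {c : List Action | (∀ a ∈ c, a ∈ insert Action.daimon F) ∧
      c.length ≤ hF.toFinset.card + 1}.Finite := by
    have : Finite ↥(insert Action.daimon F) := hG
    refine ((List.finite_length_le ↥(insert Action.daimon F)
      (hF.toFinset.card + 1)).image (List.map Subtype.val)).subset ?_
    rintro c ⟨hc, hl⟩
    refine ⟨c.attach.map fun a => ⟨a.1, hc a.1 a.2⟩, by simpa using hl, ?_⟩
    simp [Function.comp_def]
  refine ⟨hC.finite_subsets.subset ?_, ?_⟩
  · intro R hR c hc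
    refine ⟨fun a ha => ?_, path_length ((H.hR R hR.1).chron c hc).1 hF (hacts R hR c hc)⟩
    by_cases hn : a = Action.daimon
    · exact .inl hn
    · exact .inr (hacts R hR c hc a ha hn)
  · rintro R hR
    refine hF.subset ?_
    rintro a ⟨hn, c, hc, ha⟩
    exact hacts R hR c hc a ha hn

def negDai (ξ : Address) : Set (List Action) :=
  {c | ∃ I, c = [Action.proper false ξ I] ∨ c = [Action.proper false ξ I, Action.daimon]}

theorem base_false (ξ : Address) : simpleBase ξ false = [⟨some ξ, ∅⟩] := rfl
theorem base_true (ξ : Address) : simpleBase ξ true = [⟨none, {ξ}⟩] := rfl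

theorem not_pos (ξ : Address) : ¬ (simpleBase ξ false).isPositive := by
  simp [base_false, Base.isPositive]

theorem pre1 {w : List Action} {a x : Action} (h : w ++ [a] <+: [x]) : w = [] ∧ a = x := by
  obtain ⟨t, ht⟩ := h
  cases w <;> simp_all

theorem pre2 {w : List Action} {a x y : Action} (h : w ++ [a] <+: [x, y]) :
    (w = [] ∧ a = x) ∨ (w = [x] ∧ a = y) := by
  obtain ⟨t, ht⟩ := h
  rcases w with _ | ⟨b, _ | ⟨c, w⟩⟩ <;> simp_all

theorem chron2 (ξ : Address) (I : Finset ℕ) :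
    IsChronicle (simpleBase ξ false) [Action.proper false ξ I, Action.daimon] := by
  refine ⟨⟨?_, ?_, ?_, ?_, ?_, ?_, ?_, fun h => absurd h (not_pos ξ)⟩, by simp, ?_⟩
  · show List.IsChain _ _
    simp [Action.isPositive]
  · intro w a h hn
    rcases pre2 h with ⟨rfl, rfl⟩ | ⟨rfl, rfl⟩
    · exact .inl ⟨_, _, _, rfl, by simp [base_false]⟩
    · exact absurd rfl hn
  · intro w a b h hp hb hj
    rcases pre2 h with ⟨rfl, rfl⟩ | ⟨rfl, rfl⟩
    · simp at hb
    · simp [Action.justifies, Action.justifiesB] at hj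
  · intro w a h hp hn
    rcases pre2 h with ⟨rfl, rfl⟩ | ⟨rfl, rfl⟩
    · simp [Action.isPositive] at hp
    · exact absurd rfl hn
  · simp [Action.focus?, List.filterMap_cons]
  · intro w h
    rcases pre2 h with ⟨rfl, h⟩ | ⟨rfl, _⟩
    · simp at h
    · rfl
  · simp
  · intro w a b h hp
    have h' : (w ++ [a]) ++ [b] <+: [Action.proper false ξ I, Action.daimon] := by simpa using h
    rcases pre2 h' with ⟨hq, _⟩ | ⟨_, rfl⟩
    · simp at hq
    · cases hp

theorem chron1 (ξ : Address) (I : Finset ℕ) :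
    IsChronicle (simpleBase ξ false) [Action.proper false ξ I] := by
  refine ⟨⟨?_, ?_, ?_, ?_, ?_, ?_, ?_, fun h => absurd h (not_pos ξ)⟩, by simp, ?_⟩
  · show List.IsChain _ _
    simp
  · intro w a h hn
    obtain ⟨rfl, rfl⟩ := pre1 h
    exact .inl ⟨_, _, _, rfl, by simp [base_false]⟩
  · intro w a b h hp hb hj
    obtain ⟨rfl, rfl⟩ := pre1 h
    simp at hb
  · intro w a h hp hn
    obtain ⟨rfl, rfl⟩ := pre1 h
    simp [Action.isPositive] at hp
  · simp [Action.focus?]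
  · intro w h
    have := (pre1 h).2
    simp at this
  · simp
  · intro w a b h hp
    have h' : (w ++ [a]) ++ [b] <+: [Action.proper false ξ I] := by simpa using h
    have := (pre1 h').1
    simp at this

theorem negDai_design (ξ : Address) : IsDesign (simpleBase ξ false) (negDai ξ) := by
  refine ⟨?_, ?_, ?_, ?_, fun h => absurd h (not_pos ξ)⟩
  · rintro c ⟨I, rfl | rfl⟩
    · exact chron1 ξ I
    · exact chron2 ξ I
  · rintro c ⟨I, h⟩ d hd hne
    refine ⟨I, ?_⟩
    obtain ⟨w, a, rfl⟩ := (List.eq_nil_or_concat' d).resolve_left hne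
    rcases h with rfl | rfl
    · obtain ⟨rfl, rfl⟩ := pre1 hd
      simp
    · rcases pre2 hd with ⟨rfl, rfl⟩ | ⟨rfl, rfl⟩ <;> simp
  · rintro c ⟨I, hc⟩ d ⟨J, hd⟩
    have pre : ∀ {K : Finset ℕ} {w : List Action} {a : Action} {c},
        (c = [Action.proper false ξ K] ∨ c = [Action.proper false ξ K, Action.daimon]) →
        w ++ [a] <+: c → (w = [] ∧ a = Action.proper false ξ K) ∨
          (w = [Action.proper false ξ K] ∧ a = Action.daimon) := by
      rintro K w a c (rfl | rfl) h
      · exact .inl (pre1 h)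
      · exact pre2 h
    refine ⟨?_, ?_⟩
    · intro w a b ha hb
      rcases pre hc ha with ⟨rfl, rfl⟩ | ⟨rfl, rfl⟩
      · rcases pre hd hb with ⟨_, rfl⟩ | ⟨h, _⟩
        · exact .inr ⟨rfl, rfl⟩
        · simp at h
      · rcases pre hd hb with ⟨h, rfl⟩ | ⟨h, rfl⟩
        · simp at h
        · exact .inl rfl
    · intro w ξ₁ I₁ w₁ σ₁ ξ₂ I₂ w₂ σ₂ h1 h2 hne f hf
      exfalso
      rcases pre hc h1 with ⟨h, rfl⟩ | ⟨h, rfl⟩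
      · simp at h
      · simp [Action.focus?] at hf
  · rintro c ⟨I, rfl | rfl⟩ h
    · exact absurd ⟨I, .inr rfl⟩ (h Action.daimon)
    · exact ⟨Action.daimon, rfl, rfl⟩

theorem view_one (a : Action) : view [a] = [a] := by
  simp [view, viewRev, viewRevAux]

theorem negDai_conv (ξ : Address) {D} (hD : IsDesign (simpleBase ξ true) D) :
    Conv D (negDai ξ) True [] := by
  have hb : (simpleBase ξ true).isPositive := by simp [base_true, Base.isPositive]
  obtain ⟨c, hc⟩ := hD.posNonempty hb
  obtain ⟨a, t, rfl, h⟩ := (hD.chron c hc).1.totality hb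
  have ha : [a] ∈ D := hD.prefixClosed _ hc _ ⟨t, rfl⟩ (by simp)
  have hturn : TurnD True [] := trivial
  rcases h with rfl | ⟨hp, pol, ζ, I, rfl, σ, hσ, h⟩
  · exact .daiD hturn (by simpa [view_one] using ha)
  · have : pol = true := hp
    subst this
    rw [base_true] at hσ
    simp at hσ
    subst hσ
    simp at h
    subst h
    refine .stepD (κ := Action.proper true ζ I) hturn rfl (by simp)
      (by simpa [view_one] using ha) ?_ (.daiR ?_ ?_)
    · exact ⟨I, .inl (view_one _)⟩
    · simp [TurnD, Action.isPositive]
    · refine ⟨I, .inr ?_⟩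
      rw [view_pos _ rfl]
      exact congrArg (· ++ [Action.daimon]) (view_one _)

/-- essential finiteness is stable under orthogonality: a
positive behaviour `P` is essentially finite iff `P⊥` is. -/
theorem essFinite_orth (ξ : Address)
    (P : Behaviour ξ true) (B : Behaviour ξ false)
    (hB : B.designs = orthSet ξ true P.designs) :
    EssFinite P ↔ EssFinite B := by
  have hP : P.designs = orthSet ξ false B.designs := by
    have := P.closed
    rw [biorth, ← hB] at this
    exact this
  have H : Half (simpleBase ξ true) (simpleBase ξ false) P.designs B.designs True := by
    refine ⟨P.isDesign, B.isDesign, ?_, ?_, ?_⟩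
    · intro D hD R hR
      rw [hB] at hR
      simpa using hR.2 D hD
    · intro D hD h
      rw [hP]
      exact ⟨hD, fun R hR => by simpa using h R hR⟩
    · intro _
      refine ⟨trivial, negDai ξ, ?_⟩
      rw [hB]
      exact ⟨negDai_design ξ, fun D hD => by simpa using negDai_conv ξ (P.isDesign D hD)⟩
  have H' : Half (simpleBase ξ false) (simpleBase ξ true) B.designs P.designs (¬ True) := by
    refine ⟨B.isDesign, P.isDesign, ?_, ?_, fun h => absurd h (not_pos ξ)⟩
    · intro R hR D hD
      exact (H.conv D hD R hR).swap (by simp)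
    · intro R hR h
      rw [hB]
      refine ⟨hR, fun D hD => ?_⟩
      have := (h D hD).swap (by simp)
      rw [not_not] at this
      simpa using this
  constructor
  · rintro ⟨h1, h2⟩
    exact fin_dir H H' h1 h2
  · rintro ⟨h1, h2⟩
    have H2 := H
    rw [← not_not (a := True)] at H2
    exact fin_dir H' H2 h1 h2

end Ludics
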